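/- Let C_0 be a real number such that B_h(x)·√(log x)/x → C_0 as x → ∞, where h = X^2 + XY + Y^2. Then the following two assertions are equivalent: (i) for every two-dimensional lattice L ⊂ ℝ^2 of covolume 1 that is not the image of the hexagonal lattice Σ under a linear isometry of ℝ^2, and every real F with N_L(x)·√(log x)/x → F, one has F > (√3/2)·C_0; (ii) for every primitive positive definite integral binary quadratic form f of discriminant D ≤ -4 and every real C with B_f(x)·√(log x)/x → C, one has (√|D|/2)·C > (√3/2)·C_0. -/

import Mathlib

open Filter Real

/-- The number of positive integers `n ≤ x` represented by the integral binary quadratic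
form `a X² + b X Y + c Y²`. -/
noncomputable def Bcount (a b c : ℤ) (x : ℝ) : ℕ :=
  Set.ncard {n : ℕ | 0 < n ∧ (n : ℝ) ≤ x ∧ ∃ u v : ℤ, (n : ℤ) = a * u ^ 2 + b * u * v + c * v ^ 2}

/-- The lattice (set of all integral linear combinations) spanned by `v₁` and `v₂`. -/
def latticeOf (v₁ v₂ : EuclideanSpace ℝ (Fin 2)) : Set (EuclideanSpace ℝ (Fin 2)) :=
  {v | ∃ m n : ℤ, v = m • v₁ + n • v₂}

/-- `NL Λ x` is the number of distinct values `0 < r ≤ x` taken by the squared Euclidean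
norm on the lattice `Λ`. -/
noncomputable def NL (Λ : Set (EuclideanSpace ℝ (Fin 2))) (x : ℝ) : ℕ :=
  Set.ncard {r : ℝ | 0 < r ∧ r ≤ x ∧ ∃ v ∈ Λ, ‖v‖ ^ 2 = r}

/-- The hexagonal lattice of covolume 1, spanned by `√(2/√3)·(1,0)` and
`√(2/√3)·(1/2, √3/2)`. -/
noncomputable def hexLattice : Set (EuclideanSpace ℝ (Fin 2)) :=
  latticeOf ((WithLp.equiv 2 (Fin 2 → ℝ)).symm ![Real.sqrt (2 / Real.sqrt 3), 0])
    ((WithLp.equiv 2 (Fin 2 → ℝ)).symm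
      ![Real.sqrt (2 / Real.sqrt 3) * (1 / 2), Real.sqrt (2 / Real.sqrt 3) * (Real.sqrt 3 / 2)])

local notation "E₂" => EuclideanSpace ℝ (Fin 2)

lemma norm_sq_zsmul_add (v₁ v₂ : E₂) (m n : ℤ) :
    ‖m • v₁ + n • v₂‖ ^ 2 = (v₁ 0 ^ 2 + v₁ 1 ^ 2) * m ^ 2 +
      2 * (v₁ 0 * v₂ 0 + v₁ 1 * v₂ 1) * m * n + (v₂ 0 ^ 2 + v₂ 1 ^ 2) * n ^ 2 := by
  rw [EuclideanSpace.real_norm_sq_eq]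
  simp
  ring

lemma NL_eq_Bcount {v₁ v₂ : E₂} {a b c : ℤ} {s : ℝ} (hs : 0 < s)
    (h : ∀ m n : ℤ, ‖m • v₁ + n • v₂‖ ^ 2 = s * ((a * m ^ 2 + b * m * n + c * n ^ 2 : ℤ) : ℝ))
    (x : ℝ) : NL (latticeOf v₁ v₂) x = Bcount a b c (x / s) := by
  have hinj : Function.Injective (fun n : ℕ => s * (n : ℝ)) := fun m n hmn => by
    have := mul_left_cancel₀ hs.ne' hmn
    exact_mod_cast this
  unfold NL Bcount
  rw [← Set.ncard_image_of_injective _ hinj]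
  congr 1
  ext r
  simp only [Set.mem_ofPred_eq, Set.mem_image]
  constructor
  · rintro ⟨hr, hrx, v, ⟨m, n, rfl⟩, hv⟩
    rw [h] at hv
    have hpos : 0 < a * m ^ 2 + b * m * n + c * n ^ 2 := by
      rw [← hv] at hr
      exact_mod_cast pos_of_mul_pos_right hr hs.le
    obtain ⟨k, hk⟩ := Int.eq_ofNat_of_zero_le hpos.le
    have hkr : s * (k : ℝ) = r := by rw [← hv, hk]; simp
    refine ⟨k, ⟨by omega, ?_, m, n, hk.symm⟩, hkr⟩
    rw [le_div_iff₀ hs]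
    linarith
  · rintro ⟨k, ⟨hk, hkx, m, n, hmn⟩, rfl⟩
    refine ⟨by positivity, ?_, _, ⟨m, n, rfl⟩, ?_⟩
    · rw [le_div_iff₀ hs] at hkx
      linarith
    · rw [h, ← hmn]
      simp

lemma tendsto_comp_mul_log {G : ℝ → ℝ} {C μ : ℝ} (hμ : 0 < μ)
    (hG : Tendsto (fun x => G x * √(log x) / x) atTop (nhds C)) :
    Tendsto (fun x => G (μ * x) * √(log x) / x) atTop (nhds (μ * C)) := by
  have hlin : Tendsto (fun x : ℝ => μ * x) atTop atTop := tendsto_id.const_mul_atTop hμ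
  have h1 := hG.comp hlin
  have hlog : Tendsto (fun x => log x / log (μ * x)) atTop (nhds 1) := by
    have h2 : Tendsto (fun x : ℝ => 1 - log μ / log (μ * x)) atTop (nhds (1 - 0)) :=
      tendsto_const_nhds.sub (tendsto_const_nhds.div_atTop (tendsto_log_atTop.comp hlin))
    rw [sub_zero] at h2
    refine h2.congr' ?_
    filter_upwards [eventually_gt_atTop 0, (tendsto_log_atTop.comp hlin).eventually_gt_atTop 0]
      with x hx hl
    simp only [Function.comp] at hl
    field_simp
    rw [log_mul hμ.ne' hx.ne']
    ring
  have h3 := (h1.mul ((continuous_sqrt.tendsto 1).comp hlog)).const_mul μ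
  simp only [sqrt_one, mul_one] at h3
  refine h3.congr' ?_
  filter_upwards [eventually_gt_atTop 0, (tendsto_log_atTop.comp hlin).eventually_gt_atTop 0]
    with x hx hl
  simp only [Function.comp] at hl ⊢
  rw [sqrt_div' _ hl.le]
  have : √(log (μ * x)) ≠ 0 := (sqrt_pos.2 hl).ne'
  field_simp

lemma eq_zero_of_add_mul_irrational {b : ℝ} (hb : ¬ ∃ r : ℚ, b = r) {p q : ℚ}
    (h : (p : ℝ) + q * b = 0) : p = 0 ∧ q = 0 := by
  have hq : q = 0 := by
    by_contra hq
    have hq' : (q : ℝ) ≠ 0 := by exact_mod_cast hq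
    refine hb ⟨-p / q, ?_⟩
    push_cast
    field_simp
    linarith
  subst hq
  simpa using h

lemma eq_of_sq_add_eq_of_mul_eq {t k n K N : ℚ} (ht : 0 < t) (hn : 0 < n) (hN : 0 < N)
    (hk : (t + 1) * n < k) (hK : (t + 1) * N < K) (h₁ : k ^ 2 + t * n ^ 2 = K ^ 2 + t * N ^ 2)
    (h₂ : n * k = N * K) : k = K ∧ n = N := by
  have hlt {k n : ℚ} (hn : 0 < n) (hk : (t + 1) * n < k) : t * n ^ 2 < k ^ 2 := by
    have := pow_lt_pow_left₀ hk (by positivity) two_ne_zero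
    nlinarith [mul_pos (pow_pos ht 2) (pow_pos hn 2), mul_pos ht (pow_pos hn 2), pow_pos hn 2]
  have h := hlt hn hk
  have H := hlt hN hK
  have hprod : k ^ 2 * (t * n ^ 2) = K ^ 2 * (t * N ^ 2) := by
    linear_combination t * (n * k + N * K) * h₂
  have hmul : (k ^ 2 - K ^ 2) * (k ^ 2 - t * N ^ 2) = 0 := by
    linear_combination k ^ 2 * h₁ - hprod
  have hkp : 0 < k := lt_trans (by positivity) hk
  have hKp : 0 < K := lt_trans (by positivity) hK
  rcases mul_eq_zero.1 hmul with h0 | h0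
  · have hkK : k = K := by
      rwa [sub_eq_zero, pow_left_inj₀ hkp.le hKp.le two_ne_zero] at h0
    subst hkK
    exact ⟨rfl, mul_right_cancel₀ hkp.ne' h₂⟩
  · linarith

lemma exists_injOn_cone {b c : ℝ} (hpos : b ^ 2 < 4 * c)
    (hirr : ¬ ((∃ r : ℚ, b = r) ∧ ∃ r : ℚ, c = r)) :
    ∃ κ : ℕ, ∀ m n M N : ℤ, 0 < n → 0 < N → κ * n < m → κ * N < M →
      (m : ℝ) ^ 2 + b * m * n + c * n ^ 2 = M ^ 2 + b * M * N + c * N ^ 2 → m = M ∧ n = N := by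
  by_cases hb : ∃ r : ℚ, b = r
  · have hc : ¬ ∃ r : ℚ, c = r := fun hc => hirr ⟨hb, hc⟩
    obtain ⟨r, rfl⟩ := hb
    obtain ⟨κ, hκ⟩ := exists_nat_ge |r|
    refine ⟨κ, fun m n M N hn hN hm hM h => ?_⟩
    obtain ⟨h1, h2⟩ := eq_zero_of_add_mul_irrational hc
      (p := (m : ℚ) ^ 2 + r * m * n - (M ^ 2 + r * M * N)) (q := (n : ℚ) ^ 2 - N ^ 2)
      (by push_cast; linarith)
    have hnN : n = N := by
      have : n ^ 2 = N ^ 2 := by exact_mod_cast sub_eq_zero.1 h2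
      rwa [pow_left_inj₀ hn.le hN.le two_ne_zero] at this
    subst hnN
    refine ⟨?_, rfl⟩
    have hmul : ((m : ℚ) - M) * (m + M + r * n) = 0 := by linear_combination h1
    have hn' : (0 : ℚ) < n := by exact_mod_cast hn
    have hm' : (κ : ℚ) * n < m := by exact_mod_cast hm
    have hM' : (κ : ℚ) * n < M := by exact_mod_cast hM
    have hr : -((κ : ℚ) * n) ≤ r * n := by nlinarith [neg_abs_le r]
    have hκn : 0 ≤ (κ : ℚ) * n := by positivity
    rcases mul_eq_zero.1 hmul with h0 | h0
    · exact_mod_cast sub_eq_zero.1 h0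
    · linarith
  by_cases hdep : ∃ r s : ℚ, c = r + s * b
  · obtain ⟨r, s, rfl⟩ := hdep
    have ht : 0 < s ^ 2 + r := by
      have : (0 : ℝ) < s ^ 2 + r := by nlinarith [sq_nonneg (b / 2 - s)]
      exact_mod_cast this
    obtain ⟨κ, hκ⟩ := exists_nat_ge (s ^ 2 + r + 1 + |s|)
    refine ⟨κ, fun m n M N hn hN hm hM h => ?_⟩
    obtain ⟨h1, h2⟩ := eq_zero_of_add_mul_irrational hb
      (p := (m : ℚ) ^ 2 + r * n ^ 2 - (M ^ 2 + r * N ^ 2))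
      (q := (m : ℚ) * n + s * n ^ 2 - (M * N + s * N ^ 2))
      (by push_cast; linarith)
    have hn' : (0 : ℚ) < n := by exact_mod_cast hn
    have hN' : (0 : ℚ) < N := by exact_mod_cast hN
    have hm' : (κ : ℚ) * n < m := by exact_mod_cast hm
    have hM' : (κ : ℚ) * N < M := by exact_mod_cast hM
    obtain ⟨h3, h4⟩ := eq_of_sq_add_eq_of_mul_eq ht hn' hN'
      (k := m + s * n) (K := M + s * N) (by nlinarith [neg_abs_le s]) (by nlinarith [neg_abs_le s])
      (by linear_combination h1 + 2 * s * h2) (by linear_combination h2)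
    have hnN : n = N := by exact_mod_cast h4
    subst hnN
    exact ⟨by exact_mod_cast add_right_cancel h3, rfl⟩
  · refine ⟨0, fun m n M N hn hN hm hM h => ?_⟩
    simp only [Nat.cast_zero, zero_mul] at hm hM
    have h2 : n ^ 2 = N ^ 2 := by
      by_contra hne
      have hne' : (n : ℝ) ^ 2 - N ^ 2 ≠ 0 := by
        rw [sub_ne_zero]
        exact_mod_cast hne
      refine hdep ⟨-(m ^ 2 - M ^ 2) / (n ^ 2 - N ^ 2), -(m * n - M * N) / (n ^ 2 - N ^ 2), ?_⟩
      push_cast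
      field_simp
      linarith
    rw [pow_left_inj₀ hn.le hN.le two_ne_zero] at h2
    subst h2
    obtain ⟨h1, h3⟩ := eq_zero_of_add_mul_irrational hb
      (p := (m : ℚ) ^ 2 - M ^ 2) (q := (m : ℚ) * n - M * n)
      (by push_cast; linarith)
    refine ⟨?_, rfl⟩
    have : m * n = M * n := by exact_mod_cast sub_eq_zero.1 h3
    exact mul_right_cancel₀ hn.ne' this

lemma sq_add_sq_pos {v₁ v₂ : E₂} (hdet : |v₁ 0 * v₂ 1 - v₁ 1 * v₂ 0| = 1) :
    0 < v₁ 0 ^ 2 + v₁ 1 ^ 2 := by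
  refine lt_of_le_of_ne (by positivity) fun h => ?_
  have h0 : v₁ 0 = 0 := by nlinarith [sq_nonneg (v₁ 0), sq_nonneg (v₁ 1)]
  have h1 : v₁ 1 = 0 := by nlinarith [sq_nonneg (v₁ 0), sq_nonneg (v₁ 1)]
  simp [h0, h1] at hdet

lemma finite_norm_sq_le {v₁ v₂ : E₂} (hdet : |v₁ 0 * v₂ 1 - v₁ 1 * v₂ 0| = 1) (x : ℝ) :
    {r : ℝ | 0 < r ∧ r ≤ x ∧ ∃ v ∈ latticeOf v₁ v₂, ‖v‖ ^ 2 = r}.Finite := by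
  have hd : (v₁ 0 * v₂ 1 - v₁ 1 * v₂ 0) ^ 2 = 1 := by rw [← sq_abs, hdet, one_pow]
  obtain ⟨K₁, hK₁⟩ := exists_nat_ge ((v₂ 0 ^ 2 + v₂ 1 ^ 2) * x)
  obtain ⟨K₂, hK₂⟩ := exists_nat_ge ((v₁ 0 ^ 2 + v₁ 1 ^ 2) * x)
  refine (((Set.finite_Icc (-(K₁ : ℤ)) K₁).prod (Set.finite_Icc (-(K₂ : ℤ)) K₂)).image
    fun z : ℤ × ℤ => ‖z.1 • v₁ + z.2 • v₂‖ ^ 2).subset ?_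
  rintro r ⟨-, hrx, v, ⟨m, n, rfl⟩, rfl⟩
  have hbound {z : ℤ} {K : ℕ} (h : (z : ℝ) ^ 2 ≤ K) : z ∈ Set.Icc (-(K : ℤ)) K := by
    have h' : z ^ 2 ≤ K := by exact_mod_cast h
    constructor <;> nlinarith
  refine ⟨(m, n), ⟨hbound (le_trans ?_ hK₁), hbound (le_trans ?_ hK₂)⟩, rfl⟩
  · refine le_trans ?_ (mul_le_mul_of_nonneg_left hrx (by positivity))
    rw [norm_sq_zsmul_add]
    linear_combination -m ^ 2 * hd +
      sq_nonneg ((v₁ 0 * v₂ 0 + v₁ 1 * v₂ 1) * m + (v₂ 0 ^ 2 + v₂ 1 ^ 2) * n)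
  · refine le_trans ?_ (mul_le_mul_of_nonneg_left hrx (by positivity))
    rw [norm_sq_zsmul_add]
    linear_combination -n ^ 2 * hd +
      sq_nonneg ((v₁ 0 * v₂ 0 + v₁ 1 * v₂ 1) * n + (v₁ 0 ^ 2 + v₁ 1 ^ 2) * m)

lemma exists_sq_le_NL {v₁ v₂ : E₂} (hdet : |v₁ 0 * v₂ 1 - v₁ 1 * v₂ 0| = 1)
    (hirr : ¬ ((∃ r : ℚ, 2 * (v₁ 0 * v₂ 0 + v₁ 1 * v₂ 1) / (v₁ 0 ^ 2 + v₁ 1 ^ 2) = r) ∧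
      ∃ r : ℚ, (v₂ 0 ^ 2 + v₂ 1 ^ 2) / (v₁ 0 ^ 2 + v₁ 1 ^ 2) = r)) :
    ∃ K : ℝ, 0 < K ∧ ∀ (R : ℕ) (x : ℝ), K * R ^ 2 ≤ x → R ^ 2 ≤ NL (latticeOf v₁ v₂) x := by
  have hd : (v₁ 0 * v₂ 1 - v₁ 1 * v₂ 0) ^ 2 = 1 := by rw [← sq_abs, hdet, one_pow]
  have hA : 0 < v₁ 0 ^ 2 + v₁ 1 ^ 2 := sq_add_sq_pos hdet
  obtain ⟨κ, hκ⟩ := exists_injOn_cone (by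
    rw [div_pow, div_lt_iff₀ (by positivity)]
    field_simp
    nlinarith) hirr
  have hnorm (m n : ℤ) : ‖m • v₁ + n • v₂‖ ^ 2 = (v₁ 0 ^ 2 + v₁ 1 ^ 2) * ((m : ℝ) ^ 2 +
      2 * (v₁ 0 * v₂ 0 + v₁ 1 * v₂ 1) / (v₁ 0 ^ 2 + v₁ 1 ^ 2) * m * n +
      (v₂ 0 ^ 2 + v₂ 1 ^ 2) / (v₁ 0 ^ 2 + v₁ 1 ^ 2) * n ^ 2) := by
    rw [norm_sq_zsmul_add]
    field_simp
  have hpos {m n : ℤ} (hn : 0 < n) : 0 < ‖m • v₁ + n • v₂‖ ^ 2 := by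
    refine pos_of_mul_pos_right (a := v₁ 0 ^ 2 + v₁ 1 ^ 2) ?_ hA.le
    have hn' : (0 : ℝ) < n := by exact_mod_cast hn
    have : (v₁ 0 ^ 2 + v₁ 1 ^ 2) * ‖m • v₁ + n • v₂‖ ^ 2 =
        ((v₁ 0 * v₂ 0 + v₁ 1 * v₂ 1) * n + (v₁ 0 ^ 2 + v₁ 1 ^ 2) * m) ^ 2 + n ^ 2 := by
      rw [norm_sq_zsmul_add]
      linear_combination n ^ 2 * hd
    rw [this]
    positivity
  refine ⟨((κ + 1) * ‖v₁‖ + ‖v₂‖ + 1) ^ 2, by positivity, fun R x hx => ?_⟩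
  have hcard : (↑(Finset.Icc (1 : ℤ) R ×ˢ Finset.Icc (1 : ℤ) R) : Set (ℤ × ℤ)).ncard = R ^ 2 := by
    rw [Set.ncard_coe_finset, Finset.card_product]
    simp [sq]
  rw [← hcard]
  refine Set.ncard_le_ncard_of_injOn
    (fun z : ℤ × ℤ => ‖(κ * z.2 + z.1) • v₁ + z.2 • v₂‖ ^ 2) ?_ ?_ (finite_norm_sq_le hdet x)
  · rintro ⟨j, n⟩ hz
    simp only [Finset.coe_product, Finset.coe_Icc, Set.mem_prod, Set.mem_Icc] at hz
    obtain ⟨⟨hj, hjR⟩, hn, hnR⟩ := hz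
    refine ⟨hpos (by omega), le_trans ?_ hx, _, ⟨_, _, rfl⟩, rfl⟩
    rw [← mul_pow]
    refine pow_le_pow_left₀ (norm_nonneg _) ((norm_add_le _ _).trans ?_) 2
    have hj0 : (1 : ℝ) ≤ j := by exact_mod_cast hj
    have hn0 : (1 : ℝ) ≤ n := by exact_mod_cast hn
    have hjR' : (j : ℝ) ≤ R := by exact_mod_cast hjR
    have hnR' : (n : ℝ) ≤ R := by exact_mod_cast hnR
    have h0 : (0 : ℝ) ≤ κ * n + j := by positivity
    rw [norm_zsmul ℝ, norm_zsmul ℝ]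
    have e1 : ‖((κ * n + j : ℤ) : ℝ)‖ = κ * n + j := by
      push_cast
      exact Real.norm_of_nonneg h0
    have e2 : ‖((n : ℤ) : ℝ)‖ = n := Real.norm_of_nonneg (by linarith)
    have h1 : ((κ : ℝ) * n + j) * ‖v₁‖ ≤ (κ * R + R) * ‖v₁‖ := by gcongr
    have h2 : (n : ℝ) * ‖v₂‖ ≤ R * ‖v₂‖ := by gcongr
    have h3 : (0 : ℝ) ≤ R := by positivity
    simp only [e1, e2]
    linarith
  · rintro ⟨j, n⟩ hz ⟨J, N⟩ hZ h
    simp only [Finset.coe_product, Finset.coe_Icc, Set.mem_prod, Set.mem_Icc] at hz hZ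
    simp only [hnorm] at h
    obtain ⟨h1, h2⟩ := hκ _ _ _ _ (by omega) (by omega) (by omega) (by omega)
      (mul_left_cancel₀ hA.ne' h)
    subst h2
    simpa using h1

lemma not_tendsto_NL {v₁ v₂ : E₂} (hdet : |v₁ 0 * v₂ 1 - v₁ 1 * v₂ 0| = 1)
    (hirr : ¬ ((∃ r : ℚ, 2 * (v₁ 0 * v₂ 0 + v₁ 1 * v₂ 1) / (v₁ 0 ^ 2 + v₁ 1 ^ 2) = r) ∧
      ∃ r : ℚ, (v₂ 0 ^ 2 + v₂ 1 ^ 2) / (v₁ 0 ^ 2 + v₁ 1 ^ 2) = r)) (F : ℝ) :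
    ¬ Tendsto (fun x : ℝ => (NL (latticeOf v₁ v₂) x : ℝ) * √(log x) / x) atTop (nhds F) := by
  obtain ⟨K, hK, h⟩ := exists_sq_le_NL hdet hirr
  refine not_tendsto_nhds_of_tendsto_atTop ?_ F
  have hlog : Tendsto (fun x : ℝ => (4 * K)⁻¹ * √(log x)) atTop atTop :=
    (tendsto_sqrt_atTop.comp tendsto_log_atTop).const_mul_atTop (by positivity)
  refine tendsto_atTop_mono' _ ?_ hlog
  filter_upwards [eventually_ge_atTop K] with x hx
  have hx0 : 0 < x := hK.trans_le hx
  have hy : 1 ≤ √(x / K) := by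
    rw [one_le_sqrt, one_le_div hK]
    exact hx
  have hfl := Nat.floor_le (zero_le_one.trans hy)
  have hfl' := Nat.lt_floor_add_one √(x / K)
  have hfl1 : (1 : ℝ) ≤ ⌊√(x / K)⌋₊ := by exact_mod_cast Nat.one_le_floor_iff _ |>.2 hy
  have hsq : √(x / K) ^ 2 = x / K := sq_sqrt (by positivity)
  have hNL := h ⌊√(x / K)⌋₊ x (by
    have := pow_le_pow_left₀ (by positivity) hfl 2
    rw [hsq, le_div_iff₀ hK] at this
    linarith)
  have hNL' : ((⌊√(x / K)⌋₊ : ℝ)) ^ 2 ≤ NL (latticeOf v₁ v₂) x := by exact_mod_cast hNL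
  have hmain : x / (4 * K) ≤ NL (latticeOf v₁ v₂) x := by
    have : x / (4 * K) = (√(x / K) / 2) ^ 2 := by
      rw [div_pow, hsq]
      field_simp
      norm_num
    rw [this]
    refine (pow_le_pow_left₀ (by positivity) ?_ 2).trans hNL'
    linarith
  rw [mul_div_right_comm]
  refine mul_le_mul_of_nonneg_right ?_ (sqrt_nonneg _)
  rw [le_div_iff₀ hx0]
  refine le_trans (le_of_eq ?_) hmain
  field_simp

lemma exists_primitive_of_rat (r s : ℚ) :
    ∃ a b c : ℤ, 0 < a ∧ Int.gcd (Int.gcd a b) c = 1 ∧ r = b / a ∧ s = c / a := by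
  set a : ℤ := r.den * s.den with ha
  set b : ℤ := r.num * s.den with hb
  set c : ℤ := s.num * r.den with hc
  have ha0 : 0 < a := by positivity
  have hg : 0 < Int.gcd (Int.gcd a b) c :=
    Int.gcd_pos_of_ne_zero_left _ (by exact_mod_cast (Int.gcd_pos_of_ne_zero_left _ ha0.ne').ne')
  set g := Int.gcd (Int.gcd a b) c with hgdef
  have hg' : (0 : ℤ) < g := by exact_mod_cast hg
  have hgab : (g : ℤ) ∣ Int.gcd a b := Int.gcd_dvd_left ..
  obtain ⟨a', ha'⟩ : (g : ℤ) ∣ a := hgab.trans (Int.gcd_dvd_left ..)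
  obtain ⟨b', hb'⟩ : (g : ℤ) ∣ b := hgab.trans (Int.gcd_dvd_right ..)
  obtain ⟨c', hc'⟩ : (g : ℤ) ∣ c := Int.gcd_dvd_right ..
  have ha'0 : 0 < a' := pos_of_mul_pos_right (ha' ▸ ha0) hg'.le
  have hgq : (g : ℚ) ≠ 0 := by exact_mod_cast hg.ne'
  have ha'q : (a' : ℚ) ≠ 0 := by exact_mod_cast ha'0.ne'
  have haq : (a : ℚ) = g * a' := by exact_mod_cast ha'
  have hbq : (b : ℚ) = g * b' := by exact_mod_cast hb'
  have hcq : (c : ℚ) = g * c' := by exact_mod_cast hc'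
  refine ⟨a', b', c', ha'0, ?_, ?_, ?_⟩
  · have : g = g * Int.gcd (Int.gcd a' b') c' := by
      conv_lhs => rw [hgdef, ha', hb', hc', Int.gcd_mul_left, Int.natAbs_natCast, Nat.cast_mul,
        Int.gcd_mul_left, Int.natAbs_natCast]
    exact (Nat.mul_eq_left hg.ne').1 this.symm
  · rw [← mul_div_mul_left (b' : ℚ) a' hgq, ← haq, ← hbq, ha, hb]
    push_cast
    rw [mul_div_mul_right _ _ (by exact_mod_cast s.den_ne_zero), Rat.num_div_den]
  · rw [← mul_div_mul_left (c' : ℚ) a' hgq, ← haq, ← hcq, ha, hc]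
    push_cast
    rw [mul_comm (r.den : ℚ), mul_div_mul_right _ _ (by exact_mod_cast r.den_ne_zero),
      Rat.num_div_den]

/-- Positive definite forms of discriminant `-3` are properly equivalent to `X² + XY + Y²`. -/
lemma exists_reduction_of_discr_eq_neg_three (a b c : ℤ) (ha : 0 < a)
    (hD : b ^ 2 - 4 * a * c = -3) :
    ∃ p q r t : ℤ, p * t - q * r = 1 ∧ a * p ^ 2 + b * p * q + c * q ^ 2 = 1 ∧
      2 * a * p * r + b * (p * t + q * r) + 2 * c * q * t = 1 ∧
      a * r ^ 2 + b * r * t + c * t ^ 2 = 1 := by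
  induction hN : a.toNat using Nat.strong_induction_on generalizing a b c with
  | _ N ih =>
  rcases eq_or_lt_of_le (show 1 ≤ a by omega) with h1 | h1
  · subst h1
    obtain ⟨k, rfl⟩ : Odd b := by
      rcases Int.even_or_odd' b with ⟨k, rfl | rfl⟩
      · ring_nf at hD
        omega
      · exact ⟨k, rfl⟩
    refine ⟨1, 0, -k, 1, by ring, by ring, by ring, ?_⟩
    linarith
  · set k := (b + a) / (2 * a) with hk
    have hlow : 0 ≤ b + a - 2 * a * k := by
      have := Int.mul_ediv_self_le (x := b + a) (k := 2 * a) (by omega)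
      linarith
    have hup : b + a - 2 * a * k < 2 * a := by
      have := Int.lt_mul_ediv_self_add (x := b + a) (k := 2 * a) (by omega)
      linarith
    have hD' : (-(b - 2 * a * k)) ^ 2 - 4 * (a * k ^ 2 - b * k + c) * a = -3 := by
      linear_combination hD
    have hc0 : 0 < a * k ^ 2 - b * k + c := by
      by_contra! h
      nlinarith [sq_nonneg (b - 2 * a * k)]
    have hca : a * k ^ 2 - b * k + c < a := by
      have : (b - 2 * a * k) ^ 2 ≤ a ^ 2 := by
        rw [sq_le_sq, abs_of_pos ha, abs_le]
        constructor <;> linarith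
      by_contra! h
      nlinarith
    obtain ⟨p, q, r, t, h2, h3, h4, h5⟩ := ih _ (by omega) _ _ _ hc0 hD' rfl
    refine ⟨q + k * p, -p, t + k * r, -r, ?_, ?_, ?_, ?_⟩
    · linear_combination h2
    · linear_combination h3
    · linear_combination h4
    · linear_combination h5

lemma latticeOf_eq_of_det_eq_one (v₁ v₂ : E₂) {p q r t : ℤ} (h : p * t - q * r = 1) :
    latticeOf (p • v₁ + q • v₂) (r • v₁ + t • v₂) = latticeOf v₁ v₂ := by
  ext v
  constructor
  · rintro ⟨m, n, rfl⟩
    exact ⟨m * p + n * r, m * q + n * t, by module⟩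
  · rintro ⟨m, n, rfl⟩
    refine ⟨m * t - n * r, n * p - m * q, ?_⟩
    have e1 : m = m * (p * t - q * r) := by rw [h, mul_one]
    have e2 : n = n * (p * t - q * r) := by rw [h, mul_one]
    conv_lhs => rw [e1, e2]
    module

lemma image_latticeOf (T : E₂ ≃ₗᵢ[ℝ] E₂) (v₁ v₂ : E₂) :
    T '' latticeOf v₁ v₂ = latticeOf (T v₁) (T v₂) := by
  ext v
  constructor
  · rintro ⟨_, ⟨m, n, rfl⟩, rfl⟩
    exact ⟨m, n, by simp⟩
  · rintro ⟨m, n, rfl⟩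
    exact ⟨_, ⟨m, n, rfl⟩, by simp⟩

lemma exists_isometry_hexLattice {w₁ w₂ : E₂} (h₁ : w₁ 0 ^ 2 + w₁ 1 ^ 2 = 2 / √3)
    (h₂ : w₂ 0 ^ 2 + w₂ 1 ^ 2 = 2 / √3) (h₁₂ : 2 * (w₁ 0 * w₂ 0 + w₁ 1 * w₂ 1) = 2 / √3) :
    ∃ T : E₂ ≃ₗᵢ[ℝ] E₂, T '' hexLattice = latticeOf w₁ w₂ := by
  set s := √(2 / √3) with hs
  have h3 : (0 : ℝ) < √3 := by positivity
  have h3' : √3 ^ 2 = 3 := sq_sqrt (by norm_num)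
  have hs0 : 0 < s := by positivity
  have hs2 : s ^ 2 = 2 / √3 := sq_sqrt (by positivity)
  rw [← hs2] at h₁ h₂ h₁₂
  have hon : Orthonormal ℝ ![s⁻¹ • w₁, (s * √3)⁻¹ • (2 • w₂ - w₁)] := by
    rw [orthonormal_iff_ite]
    intro i j
    have hinner (x y : E₂) : inner ℝ x y = x 0 * y 0 + x 1 * y 1 := by
      simp [PiLp.inner_apply, mul_comm]
    fin_cases i <;> fin_cases j <;> simp [hinner, -inner_self_eq_norm_sq_to_K] <;> field_simp
      <;> nlinarith
  let B := OrthonormalBasis.mk hon (by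
    rw [hon.linearIndependent.span_eq_top_of_card_eq_finrank (by simp)])
  have hB0 : B 0 = s⁻¹ • w₁ := by simp [B]
  have hB1 : B 1 = (s * √3)⁻¹ • (2 • w₂ - w₁) := by simp [B]
  refine ⟨B.repr.symm, ?_⟩
  rw [hexLattice, image_latticeOf, ← hs]
  congr 1
  · rw [← B.sum_repr_symm]
    simp [Fin.sum_univ_two, hB0, smul_smul, hs0.ne']
  · rw [← B.sum_repr_symm]
    simp only [Fin.sum_univ_two, hB0, hB1]
    ext i
    simp
    field_simp
    ring

lemma not_exists_isometry_hexLattice {v₁ v₂ : E₂} {a b c : ℤ} {s : ℝ} (hs : 0 < s)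
    (hnorm : ∀ m n : ℤ, ‖m • v₁ + n • v₂‖ ^ 2 = s * ((a * m ^ 2 + b * m * n + c * n ^ 2 : ℤ) : ℝ))
    (hdisc : s ^ 2 * ((4 * a * c - b ^ 2 : ℤ) : ℝ) = 4) (hprim : Int.gcd (Int.gcd a b) c = 1)
    (hD : b ^ 2 - 4 * a * c ≤ -4) :
    ¬ ∃ T : E₂ ≃ₗᵢ[ℝ] E₂, T '' hexLattice = latticeOf v₁ v₂ := by
  rintro ⟨T, hT⟩
  have h3 : (0 : ℝ) < √3 := by positivity
  have h3' : √3 ^ 2 = 3 := sq_sqrt (by norm_num)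
  have hs2 : √(2 / √3) ^ 2 = 2 / √3 := sq_sqrt (by positivity)
  have hhex (v : E₂) (hv : v ∈ hexLattice) :
      ∃ m n : ℤ, ‖v‖ ^ 2 = 2 / √3 * ((m ^ 2 + m * n + n ^ 2 : ℤ) : ℝ) := by
    obtain ⟨m, n, rfl⟩ := hv
    refine ⟨m, n, ?_⟩
    rw [norm_sq_zsmul_add]
    generalize √(2 / √3) = ρ at hs2 ⊢
    simp
    linear_combination ((m : ℝ) ^ 2 + m * n + n ^ 2) * hs2 + n ^ 2 * ρ ^ 2 / 4 * h3'
  obtain ⟨k, hk⟩ : ∃ k : ℤ, s * k = 2 / √3 := by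
    have h1 := Set.mem_image_of_mem T
      (show _ ∈ hexLattice from ⟨1, 0, rfl⟩)
    rw [hT] at h1
    obtain ⟨m, n, hmn⟩ := h1
    refine ⟨_, (hnorm m n).symm.trans ?_⟩
    rw [← hmn, LinearIsometryEquiv.norm_map, norm_sq_zsmul_add]
    generalize √(2 / √3) = ρ at hs2 ⊢
    simp [hs2]
  have hdvd (m n : ℤ) : k ∣ a * m ^ 2 + b * m * n + c * n ^ 2 := by
    have h1 : m • v₁ + n • v₂ ∈ T '' hexLattice := hT ▸ ⟨m, n, rfl⟩
    obtain ⟨v, hv, hvT⟩ := h1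
    obtain ⟨p, q, hpq⟩ := hhex v hv
    refine ⟨p ^ 2 + p * q + q ^ 2, ?_⟩
    have h2 := hnorm m n
    rw [← hvT, LinearIsometryEquiv.norm_map, hpq, ← hk, mul_assoc] at h2
    exact_mod_cast (mul_left_cancel₀ hs.ne' h2).symm
  have ha : k ∣ a := by simpa using hdvd 1 0
  have hc : k ∣ c := by simpa using hdvd 0 1
  have hb : k ∣ b := by
    have h1 : k ∣ a + b + c := by simpa using hdvd 1 1
    have h2 := dvd_sub (dvd_sub h1 ha) hc
    rwa [show a + b + c - a - c = b by ring] at h2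
  have hk1 : k ∣ 1 := by
    have := Int.dvd_coe_gcd (Int.dvd_coe_gcd ha hb) hc
    rwa [hprim] at this
  have hk2 : k ^ 2 = 1 := by
    rcases Int.isUnit_iff.1 (isUnit_of_dvd_one hk1) with rfl | rfl <;> norm_num
  have hk2' : (k : ℝ) ^ 2 = 1 := by exact_mod_cast hk2
  have hs43 : s ^ 2 = 4 / 3 := by
    rw [← mul_one (s ^ 2), ← hk2', ← mul_pow, hk, div_pow, h3']
    norm_num
  rw [hs43] at hdisc
  have h4 : (4 : ℝ) ≤ ((4 * a * c - b ^ 2 : ℤ) : ℝ) := by exact_mod_cast (by linarith)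
  linarith

lemma sqrt_abs_discr_div_two {a b c : ℤ} {s : ℝ} (hs : 0 < s)
    (hdisc : s ^ 2 * ((4 * a * c - b ^ 2 : ℤ) : ℝ) = 4) :
    √|((b ^ 2 - 4 * a * c : ℤ) : ℝ)| / 2 = s⁻¹ := by
  have h1 : |((b ^ 2 - 4 * a * c : ℤ) : ℝ)| = (2 / s) ^ 2 := by
    have h2 : ((4 * a * c - b ^ 2 : ℤ) : ℝ) = (2 / s) ^ 2 := by
      field_simp
      linarith
    rw [← h2, ← abs_of_nonneg (h2 ▸ sq_nonneg _ : (0 : ℝ) ≤ ((4 * a * c - b ^ 2 : ℤ) : ℝ)),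
      ← abs_neg]
    push_cast
    ring_nf
  rw [h1, sqrt_sq (by positivity)]
  field_simp

lemma exists_lattice_of_form {a b c : ℤ} (ha : 0 < a) (hD : b ^ 2 - 4 * a * c < 0) :
    ∃ (v₁ v₂ : E₂) (s : ℝ), 0 < s ∧ |v₁ 0 * v₂ 1 - v₁ 1 * v₂ 0| = 1 ∧
      (∀ m n : ℤ, ‖m • v₁ + n • v₂‖ ^ 2 =
        s * ((a * m ^ 2 + b * m * n + c * n ^ 2 : ℤ) : ℝ)) ∧
      s ^ 2 * ((4 * a * c - b ^ 2 : ℤ) : ℝ) = 4 := by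
  have ha' : (0 : ℝ) < a := by exact_mod_cast ha
  have hd : (0 : ℝ) < ((4 * a * c - b ^ 2 : ℤ) : ℝ) := by exact_mod_cast (by linarith)
  set d : ℝ := ((4 * a * c - b ^ 2 : ℤ) : ℝ) with hdef
  set s : ℝ := 2 / √d with hs
  have hs0 : 0 < s := by positivity
  have hsd : s ^ 2 * d = 4 := by
    rw [hs, div_pow, sq_sqrt hd.le]
    field_simp
    norm_num
  have hr0 : 0 < √(s * a) := by positivity
  have hr : √(s * a) ^ 2 = s * a := sq_sqrt (by positivity)
  refine ⟨!₂[√(s * a), 0], !₂[s * b / (2 * √(s * a)), 1 / √(s * a)], s, hs0, ?_, ?_, hsd⟩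
  · simp [hr0.ne']
  · intro m n
    rw [norm_sq_zsmul_add]
    simp only [Matrix.cons_val_zero, Matrix.cons_val_one]
    have e : (s * b / (2 * √(s * a))) ^ 2 + (1 / √(s * a)) ^ 2 = s * c := by
      rw [div_pow, div_pow, mul_pow, hr]
      field_simp
      rw [hdef] at hsd
      push_cast at hsd
      rw [hr]
      linear_combination -(s * a) * hsd
    rw [e, hr]
    field_simp
    push_cast
    ring

lemma linearIndependent_of_abs_det {v₁ v₂ : E₂} (hdet : |v₁ 0 * v₂ 1 - v₁ 1 * v₂ 0| = 1) :
    LinearIndependent ℝ ![v₁, v₂] := by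
  have hd : (v₁ 0 * v₂ 1 - v₁ 1 * v₂ 0) ≠ 0 := fun h => by simp [h] at hdet
  rw [LinearIndependent.pair_iff]
  intro p q h
  have h0 : p * v₁ 0 + q * v₂ 0 = 0 := by simpa using congrArg (fun v : E₂ => v 0) h
  have h1 : p * v₁ 1 + q * v₂ 1 = 0 := by simpa using congrArg (fun v : E₂ => v 1) h
  constructor
  · exact (mul_eq_zero.1 (by linear_combination v₂ 1 * h0 - v₂ 0 * h1 :
      p * (v₁ 0 * v₂ 1 - v₁ 1 * v₂ 0) = 0)).resolve_right hd
  · exact (mul_eq_zero.1 (by linear_combination v₁ 0 * h1 - v₁ 1 * h0 :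
      q * (v₁ 0 * v₂ 1 - v₁ 1 * v₂ 0) = 0)).resolve_right hd

lemma exists_form_of_rat {v₁ v₂ : E₂} (hdet : |v₁ 0 * v₂ 1 - v₁ 1 * v₂ 0| = 1)
    (hrat : (∃ r : ℚ, 2 * (v₁ 0 * v₂ 0 + v₁ 1 * v₂ 1) / (v₁ 0 ^ 2 + v₁ 1 ^ 2) = r) ∧
      ∃ r : ℚ, (v₂ 0 ^ 2 + v₂ 1 ^ 2) / (v₁ 0 ^ 2 + v₁ 1 ^ 2) = r) :
    ∃ (a b c : ℤ) (s : ℝ), 0 < a ∧ Int.gcd (Int.gcd a b) c = 1 ∧ 0 < s ∧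
      v₁ 0 ^ 2 + v₁ 1 ^ 2 = s * a ∧ 2 * (v₁ 0 * v₂ 0 + v₁ 1 * v₂ 1) = s * b ∧
      v₂ 0 ^ 2 + v₂ 1 ^ 2 = s * c ∧ s ^ 2 * ((4 * a * c - b ^ 2 : ℤ) : ℝ) = 4 := by
  have hd : (v₁ 0 * v₂ 1 - v₁ 1 * v₂ 0) ^ 2 = 1 := by rw [← sq_abs, hdet, one_pow]
  have hA : 0 < v₁ 0 ^ 2 + v₁ 1 ^ 2 := sq_add_sq_pos hdet
  obtain ⟨⟨r, hr⟩, t, ht⟩ := hrat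
  obtain ⟨a, b, c, ha, hprim, rfl, rfl⟩ := exists_primitive_of_rat r t
  have ha' : (0 : ℝ) < a := by exact_mod_cast ha
  rw [div_eq_iff hA.ne'] at hr ht
  push_cast at hr ht
  refine ⟨a, b, c, (v₁ 0 ^ 2 + v₁ 1 ^ 2) / a, ha, hprim, by positivity, by field_simp,
    hr.trans (by field_simp), ht.trans (by field_simp), ?_⟩
  have h4 : 4 * ((v₁ 0 ^ 2 + v₁ 1 ^ 2) * (v₂ 0 ^ 2 + v₂ 1 ^ 2)) -
      (2 * (v₁ 0 * v₂ 0 + v₁ 1 * v₂ 1)) ^ 2 = 4 := by linear_combination 4 * hd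
  rw [hr, ht] at h4
  rw [← h4]
  push_cast
  field_simp

lemma exists_isometry_of_discr_eq_neg_three {v₁ v₂ : E₂} {a b c : ℤ} {s : ℝ} (hs : 0 < s)
    (ha : 0 < a) (hD : b ^ 2 - 4 * a * c = -3) (h₁ : v₁ 0 ^ 2 + v₁ 1 ^ 2 = s * a)
    (h₁₂ : 2 * (v₁ 0 * v₂ 0 + v₁ 1 * v₂ 1) = s * b) (h₂ : v₂ 0 ^ 2 + v₂ 1 ^ 2 = s * c)
    (hdisc : s ^ 2 * ((4 * a * c - b ^ 2 : ℤ) : ℝ) = 4) :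
    ∃ T : E₂ ≃ₗᵢ[ℝ] E₂, T '' hexLattice = latticeOf v₁ v₂ := by
  obtain ⟨p, q, r, t, hdet, h3, h4, h5⟩ := exists_reduction_of_discr_eq_neg_three a b c ha hD
  have hs3 : s = 2 / √3 := by
    rw [show 4 * a * c - b ^ 2 = 3 by linarith] at hdisc
    push_cast at hdisc
    rw [← pow_left_inj₀ hs.le (by positivity) two_ne_zero, div_pow, sq_sqrt (by norm_num)]
    linarith
  rw [← latticeOf_eq_of_det_eq_one v₁ v₂ hdet]
  have h3' : (a * p ^ 2 + b * p * q + c * q ^ 2 : ℝ) = 1 := by exact_mod_cast h3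
  have h4' : (2 * a * p * r + b * (p * t + q * r) + 2 * c * q * t : ℝ) = 1 := by
    exact_mod_cast h4
  have h5' : (a * r ^ 2 + b * r * t + c * t ^ 2 : ℝ) = 1 := by exact_mod_cast h5
  apply exists_isometry_hexLattice <;> rw [← hs3] <;> simp
  · linear_combination p ^ 2 * h₁ + p * q * h₁₂ + q ^ 2 * h₂ + s * h3'
  · linear_combination r ^ 2 * h₁ + r * t * h₁₂ + t ^ 2 * h₂ + s * h5'
  · linear_combination 2 * p * r * h₁ + (p * t + q * r) * h₁₂ + 2 * q * t * h₂ + s * h4'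

theorem stmt5 (C₀ : ℝ)
    (hC₀ : Tendsto (fun x : ℝ => (Bcount 1 1 1 x : ℝ) * Real.sqrt (Real.log x) / x)
      atTop (nhds C₀)) :
    ((∀ v₁ v₂ : EuclideanSpace ℝ (Fin 2), LinearIndependent ℝ ![v₁, v₂] →
        |v₁ 0 * v₂ 1 - v₁ 1 * v₂ 0| = 1 →
        (¬ ∃ T : EuclideanSpace ℝ (Fin 2) ≃ₗᵢ[ℝ] EuclideanSpace ℝ (Fin 2),
          T '' hexLattice = latticeOf v₁ v₂) →
        ∀ F : ℝ,
          Tendsto (fun x : ℝ => (NL (latticeOf v₁ v₂) x : ℝ) * Real.sqrt (Real.log x) / x)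
            atTop (nhds F) →
          F > Real.sqrt 3 / 2 * C₀) ↔
      (∀ a b c : ℤ, 0 < a → Int.gcd (Int.gcd a b) c = 1 → b ^ 2 - 4 * a * c ≤ -4 →
        ∀ C : ℝ,
          Tendsto (fun x : ℝ => (Bcount a b c x : ℝ) * Real.sqrt (Real.log x) / x)
            atTop (nhds C) →
          Real.sqrt |((b ^ 2 - 4 * a * c : ℤ) : ℝ)| / 2 * C > Real.sqrt 3 / 2 * C₀)) := by
  constructor
  · intro h a b c ha hprim hD C hC
    obtain ⟨v₁, v₂, s, hs, hdet, hnorm, hdisc⟩ :=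
      exists_lattice_of_form (b := b) (c := c) ha (by linarith)
    rw [sqrt_abs_discr_div_two hs hdisc]
    refine h v₁ v₂ (linearIndependent_of_abs_det hdet) hdet
      (not_exists_isometry_hexLattice hs hnorm hdisc hprim hD) _ ?_
    refine (tendsto_comp_mul_log (inv_pos.2 hs) hC).congr fun x => ?_
    rw [NL_eq_Bcount hs hnorm, div_eq_inv_mul x s]
  · intro h v₁ v₂ _ hdet hhex F hF
    by_cases hrat : (∃ r : ℚ, 2 * (v₁ 0 * v₂ 0 + v₁ 1 * v₂ 1) / (v₁ 0 ^ 2 + v₁ 1 ^ 2) = r) ∧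
        ∃ r : ℚ, (v₂ 0 ^ 2 + v₂ 1 ^ 2) / (v₁ 0 ^ 2 + v₁ 1 ^ 2) = r
    swap
    · exact absurd hF (not_tendsto_NL hdet hrat F)
    obtain ⟨a, b, c, s, ha, hprim, hs, h₁, h₁₂, h₂, hdisc⟩ := exists_form_of_rat hdet hrat
    have hnorm (m n : ℤ) : ‖m • v₁ + n • v₂‖ ^ 2 =
        s * ((a * m ^ 2 + b * m * n + c * n ^ 2 : ℤ) : ℝ) := by
      rw [norm_sq_zsmul_add, h₁, h₁₂, h₂]
      push_cast
      ring
    have hneg : b ^ 2 - 4 * a * c < 0 := by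
      have : (0 : ℝ) < ((4 * a * c - b ^ 2 : ℤ) : ℝ) :=
        pos_of_mul_pos_right (hdisc ▸ four_pos) (sq_nonneg s)
      have : 0 < 4 * a * c - b ^ 2 := by exact_mod_cast this
      linarith
    have hne : b ^ 2 - 4 * a * c ≠ -3 := fun hD =>
      hhex (exists_isometry_of_discr_eq_neg_three hs ha hD h₁ h₁₂ h₂ hdisc)
    have hD : b ^ 2 - 4 * a * c ≤ -4 := by
      rw [mul_assoc] at hneg hne ⊢
      rcases Int.even_or_odd' b with ⟨k, rfl | rfl⟩ <;> ring_nf at hneg hne ⊢ <;> omega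
    have hC := h a b c ha hprim hD (s * F) <|
      (tendsto_comp_mul_log hs hF).congr fun x => by
        rw [NL_eq_Bcount hs hnorm, mul_div_cancel_left₀ x hs.ne']
    rwa [sqrt_abs_discr_div_two hs hdisc, inv_mul_cancel_left₀ hs.ne'] at hC
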